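/- arXiv:1811.05870 — 3 statements merged into one kernel-verified Lean document; each statement's English description precedes it below -/
import Mathlib

section
/- Let G be an abelian group and F a field. For any admissible (Z×G)-grading on the full matrix algebra M_n(F), the Z-grading obtained as the coarsening induced by the projection Z×G → Z has, for every m ∈ Z, the m-th block superdiagonal J_m as its homogeneous component of degree m. -/
open Matrix

structure AlgGrading (F : Type*) [CommRing F] (A : Type*) [Ring A] [Algebra F A]
    (G : Type*) [Group G] where
  comp : G → Submodule F A
  indep : ∀ g : G, Disjoint (comp g) (⨆ h : G, ⨆ _ : h ≠ g, comp h)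
  total : (⨆ g : G, comp g) = ⊤
  mul_mem : ∀ g h : G, ∀ x ∈ comp g, ∀ y ∈ comp h, x * y ∈ comp (g * h)

structure LieGrading (F : Type*) [CommRing F] (L : Type*) [LieRing L] [LieAlgebra F L]
    (G : Type*) [Group G] where
  comp : G → Submodule F L
  indep : ∀ g : G, Disjoint (comp g) (⨆ h : G, ⨆ _ : h ≠ g, comp h)
  total : (⨆ g : G, comp g) = ⊤
  lie_mem : ∀ g h : G, ∀ x ∈ comp g, ∀ y ∈ comp h, ⁅x, y⁆ ∈ comp (g * h)

variable (F : Type*) [Field F] {n s : ℕ}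

def UTB (b : Fin n → Fin s) : Subalgebra F (Matrix (Fin n) (Fin n) F) where
  carrier := {M | M.BlockTriangular b}
  mul_mem' := fun {M N} hM hN => hM.mul hN
  add_mem' := fun {M N} hM hN => hM.add hN
  algebraMap_mem' := fun c => by
    show (algebraMap F (Matrix (Fin n) (Fin n) F) c).BlockTriangular b
    rw [Matrix.algebraMap_eq_diagonal]
    exact Matrix.blockTriangular_diagonal _

def Jdiag (b : Fin n → Fin s) (m : ℤ) : Submodule F (Matrix (Fin n) (Fin n) F) where
  carrier := {M | ∀ p q : Fin n, ((b q : ℤ) ≠ (b p : ℤ) + m) → M p q = 0}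
  add_mem' := fun {M N} hM hN p q h => by
    simp [Matrix.add_apply, hM p q h, hN p q h]
  zero_mem' := fun p q h => rfl
  smul_mem' := fun c M hM p q h => by
    simp [Matrix.smul_apply, hM p q h]

def AlgGrading.IsGradedSubspace {F : Type*} [CommRing F] {A : Type*} [Ring A] [Algebra F A]
    {G : Type*} [Group G] (Γ : AlgGrading F A G) (V : Submodule F A) : Prop :=
  V = ⨆ g : G, V ⊓ Γ.comp g

def LieGrading.IsGradedSubspace {F : Type*} [CommRing F] {L : Type*} [LieRing L]
    [LieAlgebra F L] {G : Type*} [Group G] (Γ : LieGrading F L G) (V : Submodule F L) : Prop :=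
  V = ⨆ g : G, V ⊓ Γ.comp g

def AlgGrading.Iso {F : Type*} [CommRing F] {A : Type*} [Ring A] [Algebra F A]
    {G : Type*} [Group G] (Γ₁ Γ₂ : AlgGrading F A G) : Prop :=
  ∃ ψ : A ≃ₐ[F] A, ∀ g : G, (Γ₁.comp g).map ψ.toLinearMap = Γ₂.comp g

def LieGrading.Iso {F : Type*} [CommRing F] {L : Type*} [LieRing L] [LieAlgebra F L]
    {G : Type*} [Group G] (Γ₁ Γ₂ : LieGrading F L G) : Prop :=
  ∃ ψ : L ≃ₗ⁅F⁆ L, ∀ g : G, (Γ₁.comp g).map ψ.toLinearEquiv.toLinearMap = Γ₂.comp g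

theorem AlgGrading.iSup_comp_mul_mem {F A H G : Type*} [CommRing F] [Ring A] [Algebra F A]
    [Group H] [Group G] (Γ : AlgGrading F A (H × G)) {h k : H} {x y : A}
    (hx : x ∈ ⨆ g : G, Γ.comp (h, g)) (hy : y ∈ ⨆ g : G, Γ.comp (k, g)) :
    x * y ∈ ⨆ g : G, Γ.comp (h * k, g) := by
  induction hx using Submodule.iSup_induction' with
  | mem g x hx =>
    induction hy using Submodule.iSup_induction' with
    | mem g' y hy =>
      exact Submodule.mem_iSup_of_mem (g * g') (Γ.mul_mem (h, g) (k, g') x hx y hy)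
    | zero => simp
    | add y z _ _ hy hz => rw [mul_add]; exact add_mem hy hz
  | zero => simp
  | add x z _ _ hx hz => rw [add_mul]; exact add_mem hx hz

theorem AlgGrading.eq_of_mem_iSup_comp {F A H G : Type*} [CommRing F] [Ring A] [Algebra F A]
    [Group H] [Group G] (Γ : AlgGrading F A (H × G)) {h k : H} {x : A} (hx0 : x ≠ 0)
    (hx : x ∈ ⨆ g : G, Γ.comp (h, g)) (hy : x ∈ ⨆ g : G, Γ.comp (k, g)) : h = k := by
  by_contra hne
  have hind : iSupIndep Γ.comp := Γ.indep
  have hdisj : Disjoint {a : H × G | a.1 = h} {a : H × G | a.1 = k} :=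
    Set.disjoint_left.2 fun a ha hb => hne (ha.symm.trans hb)
  have hle : ∀ l : H, (⨆ g : G, Γ.comp (l, g)) ≤ ⨆ a ∈ {a : H × G | a.1 = l}, Γ.comp a :=
    fun l => iSup_le fun g =>
      le_iSup₂_of_le (f := fun a (_ : a ∈ {a : H × G | a.1 = l}) => Γ.comp a) (l, g) rfl le_rfl
  exact hx0 (Submodule.disjoint_def.1 (hind.disjoint_biSup_biSup hdisj) x (hle h hx) (hle k hy))

theorem single_mem_Jdiag {F : Type*} [Field F] {n s : ℕ} (b : Fin n → Fin s) (p q : Fin n)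
    (c : F) : Matrix.single p q c ∈ Jdiag F b ((b q : ℤ) - b p) := by
  intro i j hij
  apply Matrix.single_apply_of_ne
  rintro ⟨rfl, rfl⟩
  exact hij (by ring)

/-- A matrix in one component of the coarsening can only have a nonzero entry at `(p, q)` when the
degree of that component is the block distance of `(p, q)`, and then the component contains the
matrix unit at `(p, q)`. -/
theorem degree_eq_and_single_mem_of_apply_ne_zero {F : Type*} [Field F] {G : Type*} [CommGroup G]
    {n s : ℕ} (b : Fin n → Fin s)
    (Γ : AlgGrading F (Matrix (Fin n) (Fin n) F) (Multiplicative ℤ × G))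
    (hadm : ∀ m : ℤ, 0 ≤ m →
      Jdiag F b m ≤ ⨆ g : G, Γ.comp (Multiplicative.ofAdd m, g))
    {m : ℤ} {M : Matrix (Fin n) (Fin n) F}
    (hM : M ∈ ⨆ g : G, Γ.comp (Multiplicative.ofAdd m, g)) {p q : Fin n} (hpq : M p q ≠ 0) :
    m = (b q : ℤ) - b p ∧
      Matrix.single p q (1 : F) ∈ ⨆ g : G, Γ.comp (Multiplicative.ofAdd m, g) := by
  have hup : ∀ i j : Fin n, (b i : ℤ) ≤ b j → Matrix.single i j (1 : F) ∈
      ⨆ g : G, Γ.comp (Multiplicative.ofAdd ((b j : ℤ) - b i), g) := fun i j hij =>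
    hadm _ (sub_nonneg.2 hij) (single_mem_Jdiag b i j 1)
  have hdiag : ∀ i : Fin n, Matrix.single i i (1 : F) ∈ ⨆ g : G, Γ.comp (1, g) := fun i => by
    simpa using hup i i le_rfl
  have hne : ∀ i j : Fin n, Matrix.single i j (1 : F) ≠ 0 := fun i j h => by
    simpa using congrFun (congrFun h i) j
  have hmem : Matrix.single p q (1 : F) ∈ ⨆ g : G, Γ.comp (Multiplicative.ofAdd m, g) := by
    have h := Γ.iSup_comp_mul_mem (Γ.iSup_comp_mul_mem (hdiag p) hM) (hdiag q)
    rw [one_mul, mul_one, Matrix.single_mul_mul_single, one_mul, mul_one] at h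
    simpa [Matrix.smul_single, hpq] using Submodule.smul_mem _ (M p q)⁻¹ h
  refine ⟨?_, hmem⟩
  rcases le_total (b p : ℤ) (b q) with h | h
  · exact Multiplicative.ofAdd.injective (Γ.eq_of_mem_iSup_comp (hne p q) hmem (hup p q h))
  · have hp := Γ.iSup_comp_mul_mem hmem (hup q p h)
    rw [Matrix.single_mul_single_same, one_mul, ← ofAdd_add] at hp
    have h0 : m + ((b p : ℤ) - b q) = 0 :=
      Multiplicative.ofAdd.injective (Γ.eq_of_mem_iSup_comp (hne p p) hp (hdiag p))
    linarith

theorem stmt0 {F : Type*} [Field F] {G : Type*} [CommGroup G] {n s : ℕ}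
    (nn : Fin s → ℕ) (hpos : ∀ i, 0 < nn i) (hn : n = ∑ i, nn i)
    (b : Fin n → Fin s) (hb : Monotone b)
    (hcard : ∀ i, (Finset.univ.filter fun k => b k = i).card = nn i)
    (Γ : AlgGrading F (Matrix (Fin n) (Fin n) F) (Multiplicative ℤ × G))
    (hadm : ∀ m : ℤ, 0 ≤ m →
      Jdiag F b m ≤ ⨆ g : G, Γ.comp (Multiplicative.ofAdd m, g)) :
    ∀ m : ℤ, (⨆ g : G, Γ.comp (Multiplicative.ofAdd m, g)) = Jdiag F b m := by
  have hsingle : ∀ p q : Fin n, Matrix.single p q (1 : F) ∈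
      ⨆ g : G, Γ.comp (Multiplicative.ofAdd ((b q : ℤ) - b p), g) := by
    intro p q
    by_contra hcon
    have hker : (⨆ a, Γ.comp a) ≤ LinearMap.ker (Matrix.entryLinearMap F F p q) := by
      refine iSup_le fun a M hM => ?_
      by_contra hMpq
      have hM' : M ∈ ⨆ g : G, Γ.comp (Multiplicative.ofAdd a.1.toAdd, g) :=
        Submodule.mem_iSup_of_mem a.2 hM
      obtain ⟨hdeg, hmem⟩ := degree_eq_and_single_mem_of_apply_ne_zero b Γ hadm hM' hMpq
      exact hcon (hdeg ▸ hmem)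
    rw [Γ.total] at hker
    have h : Matrix.single p q (1 : F) p q = 0 :=
      hker (Submodule.mem_top (x := Matrix.single p q (1 : F)))
    simp at h
  refine fun m => le_antisymm (fun M hM p q hpq => ?_) fun M hM => ?_
  · by_contra h
    have hdeg := (degree_eq_and_single_mem_of_apply_ne_zero b Γ hadm hM h).1
    exact hpq (by linarith)
  · rw [Matrix.matrix_eq_sum_single M]
    refine Submodule.sum_mem _ fun p _ => Submodule.sum_mem _ fun q _ => ?_
    by_cases hpq : (b q : ℤ) = b p + m
    · obtain rfl : m = (b q : ℤ) - b p := by linarith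
      simpa [Matrix.smul_single] using Submodule.smul_mem _ (M p q) (hsingle p q)
    · simp [hM p q hpq]
end

section
/- Let F be a field and U = UT(n_1,…,n_s) ⊆ M_n(F). The restriction map ψ ↦ ψ|_U is a group isomorphism from {ψ ∈ Aut(M_n(F)) : ψ(U) = U} onto the automorphism group Aut(U) of the associative algebra U. In particular, every automorphism of U is of the form y ↦ x y x^{-1} for some invertible x ∈ U. -/
open Matrix

variable (F : Type*) [Field F] {n s : ℕ}

/-- The subgroup of `Aut(M_n(F))` consisting of automorphisms `ψ` with `ψ(U) = U`. -/
def stabUTB (b : Fin n → Fin s) :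
    Subgroup ((Matrix (Fin n) (Fin n) F) ≃ₐ[F] (Matrix (Fin n) (Fin n) F)) where
  carrier := {ψ | (UTB F b).map ψ.toAlgHom = UTB F b}
  one_mem' := by
    show (UTB F b).map _ = UTB F b
    have h : ((1 : (Matrix (Fin n) (Fin n) F) ≃ₐ[F] _).toAlgHom) =
        AlgHom.id F (Matrix (Fin n) (Fin n) F) := AlgHom.ext fun x => rfl
    rw [h, Subalgebra.map_id]
  mul_mem' := by
    intro a b' ha hb'
    show (UTB F b).map _ = UTB F b
    have h : ((a * b').toAlgHom) = a.toAlgHom.comp b'.toAlgHom := AlgHom.ext fun x => rfl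
    rw [h, ← Subalgebra.map_map]
    rw [show (UTB F b).map b'.toAlgHom = UTB F b from hb', ha]
  inv_mem' := by
    intro a ha
    show (UTB F b).map _ = UTB F b
    conv_lhs => rw [← show (UTB F b).map a.toAlgHom = UTB F b from ha]
    rw [Subalgebra.map_map]
    have h : (a⁻¹.toAlgHom.comp a.toAlgHom) = AlgHom.id F (Matrix (Fin n) (Fin n) F) :=
      AlgHom.ext fun x => a.symm_apply_apply x
    rw [h, Subalgebra.map_id]

theorem single_mem_UTB {b : Fin n → Fin s} {i j : Fin n} (h : b i ≤ b j) (c : F) :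
    Matrix.single i j c ∈ UTB F b := by
  intro p q hpq
  rw [Matrix.single_apply, if_neg]
  rintro ⟨rfl, rfl⟩
  exact absurd hpq h.not_gt

theorem vecMulVec_single_mem_UTB {b : Fin n → Fin s} {l : Fin n} (hl : ∀ k, b k ≤ b l)
    (v : Fin n → F) : Matrix.vecMulVec v (Pi.single l 1) ∈ UTB F b := by
  intro p q hpq
  have hq : q ≠ l := by
    rintro rfl
    exact absurd hpq (hl p).not_gt
  simp [Matrix.vecMulVec_apply, hq]

/-- An automorphism of `UTB F b` is implemented by an invertible matrix. -/
theorem exists_isUnit_intertwining {b : Fin n → Fin s} {f l : Fin n}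
    (hf : ∀ k, b f ≤ b k) (hl : ∀ k, b k ≤ b l) (φ : UTB F b ≃ₐ[F] UTB F b) :
    ∃ X : Matrix (Fin n) (Fin n) F, IsUnit X ∧
      ∀ a : UTB F b, (φ a : Matrix (Fin n) (Fin n) F) * X = X * a := by
  let col : (Fin n → F) →ₗ[F] UTB F b :=
    { toFun := fun v => ⟨_, vecMulVec_single_mem_UTB F hl v⟩
      map_add' := fun v w => Subtype.ext (Matrix.add_vecMulVec v w _)
      map_smul' := fun c v => Subtype.ext (Matrix.smul_vecMulVec c v _) }
  have mul_col (a : UTB F b) (v : Fin n → F) : col (a.1 *ᵥ v) = a * col v :=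
    Subtype.ext (Matrix.mul_vecMulVec a.1 v _).symm
  have col_ne : col (Pi.single f 1) ≠ 0 := by
    intro h
    have := congrFun (congrFun (congrArg Subtype.val h) f) l
    simp [col, Matrix.vecMulVec_apply] at this
  obtain ⟨w, hw⟩ : ∃ w, (φ (col (Pi.single f 1))).1 *ᵥ w ≠ 0 := by
    by_contra! h
    refine col_ne (φ.injective ((Subtype.ext ?_).trans (map_zero φ).symm))
    exact Matrix.mulVec_injective (funext fun w => by simpa using h w)
  let T : (Fin n → F) →ₗ[F] (Fin n → F) :=
    { toFun := fun v => (φ (col v)).1 *ᵥ w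
      map_add' := fun v v' => by simp [Matrix.add_mulVec]
      map_smul' := fun c v => by simp [Matrix.smul_mulVec] }
  have T_mulVec (a : UTB F b) (v : Fin n → F) : T (a.1 *ᵥ v) = (φ a).1 *ᵥ T v := by
    simp [T, mul_col, Matrix.mulVec_mulVec]
  have T_inj : Function.Injective T := by
    rw [injective_iff_map_eq_zero]
    intro v hv
    by_contra hne
    obtain ⟨k, hk⟩ := Function.ne_iff.mp hne
    have h := T_mulVec ⟨_, single_mem_UTB F (hf k) (v k)⁻¹⟩ v
    rw [hv, Matrix.mulVec_zero, Matrix.single_mulVec, inv_mul_cancel₀ hk] at h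
    exact hw h
  have hX : ∀ v, LinearMap.toMatrix' T *ᵥ v = T v := fun v => LinearMap.toMatrix'_mulVec T v
  refine ⟨LinearMap.toMatrix' T, ?_, fun a => ?_⟩
  · rw [← Matrix.mulVec_injective_iff_isUnit]
    intro v v' h
    exact T_inj (by simpa only [hX] using h)
  · refine Matrix.mulVec_injective (funext fun v => ?_)
    simp only [← Matrix.mulVec_mulVec, hX, T_mulVec]

/-- The vectors supported on the blocks up to the block of index `i`. -/
def blockFlag (b : Fin n → Fin s) (i : Fin s) : Submodule F (Fin n → F) where
  carrier := {v | ∀ k, i < b k → v k = 0}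
  add_mem' := fun hv hw k hk => by simp [hv k hk, hw k hk]
  zero_mem' := fun _ _ => rfl
  smul_mem' := fun c v hv k hk => by simp [hv k hk]

theorem mulVec_mem_blockFlag {b : Fin n → Fin s} (a : UTB F b) {i : Fin s} {v : Fin n → F}
    (hv : v ∈ blockFlag F b i) : a.1 *ᵥ v ∈ blockFlag F b i := by
  intro k hk
  rw [Matrix.mulVec, dotProduct]
  refine Finset.sum_eq_zero fun j _ => ?_
  rcases lt_or_ge i (b j) with hj | hj
  · rw [hv j hj, mul_zero]
  · rw [a.2 (hj.trans_lt hk), zero_mul]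

theorem mem_UTB_of_intertwining {b : Fin n → Fin s} (φ : UTB F b ≃ₐ[F] UTB F b)
    {X : Matrix (Fin n) (Fin n) F}
    (h : ∀ a : UTB F b, (φ a : Matrix (Fin n) (Fin n) F) * X = X * a) : X ∈ UTB F b := by
  intro p q hpq
  by_contra hne
  have single_q : Pi.single q 1 ∈ blockFlag F b (b q) := by
    intro k hk
    exact Pi.single_eq_of_ne (fun hkq => hk.ne' (congrArg b hkq)) _
  have le_map : blockFlag F b (b p) ≤ (blockFlag F b (b q)).map X.mulVecLin := by
    intro v hv
    let A : UTB F b := ⟨Matrix.vecMulVec v (Pi.single p (X p q)⁻¹), by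
      intro i j hij
      rcases eq_or_ne j p with rfl | hj
      · simp [Matrix.vecMulVec_apply, hv i hij]
      · simp [Matrix.vecMulVec_apply, hj]⟩
    refine ⟨(φ.symm A).1 *ᵥ Pi.single q 1, mulVec_mem_blockFlag F _ single_q, ?_⟩
    rw [Matrix.mulVecLin_apply, Matrix.mulVec_mulVec, ← h, φ.apply_symm_apply]
    ext i
    simp [A, Matrix.mul_apply, Matrix.vecMulVec_apply, Pi.single_apply, hne]
  have finrank_le : Module.finrank F (blockFlag F b (b p)) ≤
      Module.finrank F (blockFlag F b (b q)) :=
    (Submodule.finrank_mono le_map).trans (Submodule.finrank_map_le _ _)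
  have flag_le : blockFlag F b (b q) ≤ blockFlag F b (b p) :=
    fun v hv k hk => hv k (hpq.trans hk)
  have single_p : Pi.single p 1 ∈ blockFlag F b (b p) := by
    intro k hk
    exact Pi.single_eq_of_ne (fun hkp => hk.ne' (congrArg b hkp)) _
  rw [← Submodule.eq_of_le_of_finrank_le flag_le finrank_le] at single_p
  simpa using single_p p hpq

/-- Every automorphism of the algebra of upper block-triangular matrices is inner. -/
theorem exists_conj_of_algEquiv_UTB {b : Fin n → Fin s} (φ : UTB F b ≃ₐ[F] UTB F b) :
    ∃ x : (UTB F b)ˣ, ∀ y : UTB F b, φ y = ↑x * y * ↑x⁻¹ := by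
  rcases isEmpty_or_nonempty (Fin n) with hn | hn
  · exact ⟨1, fun y => Subtype.ext (Subsingleton.elim _ _)⟩
  obtain ⟨f, hf⟩ := Finite.exists_min b
  obtain ⟨l, hl⟩ := Finite.exists_max b
  obtain ⟨X, hX, h⟩ := exists_isUnit_intertwining F hf hl φ
  have hXU := mem_UTB_of_intertwining F φ h
  have hdet : IsUnit X.det := (Matrix.isUnit_iff_isUnit_det X).mp hX
  have : Invertible X := hX.invertible
  have hXinv : X⁻¹ ∈ UTB F b := Matrix.blockTriangular_inv_of_blockTriangular hXU
  refine ⟨⟨⟨X, hXU⟩, ⟨X⁻¹, hXinv⟩, Subtype.ext (X.mul_nonsing_inv hdet),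
    Subtype.ext (X.nonsing_inv_mul hdet)⟩, fun y => Subtype.ext ?_⟩
  change (φ y).1 = X * y.1 * X⁻¹
  rw [← h, mul_assoc, X.mul_nonsing_inv hdet, mul_one]

/-- Algebra homomorphisms from the full matrix algebra are determined on `UTB F b`. -/
theorem algHom_ext_UTB {A : Type*} [Ring A] [Algebra F A] {b : Fin n → Fin s}
    {ψ₁ ψ₂ : Matrix (Fin n) (Fin n) F →ₐ[F] A} (h : ∀ x ∈ UTB F b, ψ₁ x = ψ₂ x) : ψ₁ = ψ₂ := by
  have h_single (i j : Fin n) : ψ₁ (Matrix.single i j 1) = ψ₂ (Matrix.single i j 1) := by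
    rcases le_total (b i) (b j) with hij | hij
    · exact h _ (single_mem_UTB F hij 1)
    have hi := h _ (single_mem_UTB F (le_refl (b i)) 1)
    have hj := h _ (single_mem_UTB F (le_refl (b j)) 1)
    have hji := h _ (single_mem_UTB F hij 1)
    calc ψ₁ (Matrix.single i j 1)
        = ψ₁ (Matrix.single i j 1) * ψ₁ (Matrix.single j j 1) := by simp [← map_mul]
      _ = ψ₁ (Matrix.single i j 1) * (ψ₁ (Matrix.single j i 1) * ψ₂ (Matrix.single i j 1)) := by
          rw [hj, hji]; simp [← map_mul]
      _ = ψ₂ (Matrix.single i i 1) * ψ₂ (Matrix.single i j 1) := by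
          rw [← hi, ← mul_assoc]; simp [← map_mul]
      _ = ψ₂ (Matrix.single i j 1) := by simp [← map_mul]
  ext M
  rw [Matrix.matrix_eq_sum_single M]
  simp only [map_sum]
  refine Finset.sum_congr rfl fun i _ => Finset.sum_congr rfl fun j _ => ?_
  have hM : Matrix.single i j (M i j) = M i j • Matrix.single i j (1 : F) := by simp
  rw [hM, map_smul, map_smul, h_single]

theorem apply_mem_UTB {b : Fin n → Fin s} (ψ : stabUTB F b) {x : Matrix (Fin n) (Fin n) F}
    (hx : x ∈ UTB F b) : ψ.1 x ∈ UTB F b := by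
  have hψ : (UTB F b).map ψ.1.toAlgHom = UTB F b := ψ.2
  rw [← hψ]
  exact ⟨x, hx, rfl⟩

/-- Restriction to `UTB F b` of the automorphisms that stabilize it. -/
def restrictUTB (b : Fin n → Fin s) : stabUTB F b →* (UTB F b ≃ₐ[F] UTB F b) where
  toFun ψ := AlgEquiv.ofAlgHom
    ((ψ.1.toAlgHom.comp (UTB F b).val).codRestrict _ fun x => apply_mem_UTB F ψ x.2)
    (((ψ⁻¹).1.toAlgHom.comp (UTB F b).val).codRestrict _ fun x => apply_mem_UTB F ψ⁻¹ x.2)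
    (AlgHom.ext fun x => Subtype.ext (ψ.1.apply_symm_apply x.1))
    (AlgHom.ext fun x => Subtype.ext (ψ.1.symm_apply_apply x.1))
  map_one' := rfl
  map_mul' _ _ := rfl

theorem restrictUTB_bijective (b : Fin n → Fin s) : Function.Bijective (restrictUTB F b) := by
  constructor
  · intro ψ₁ ψ₂ h
    have hext : ψ₁.1.toAlgHom = ψ₂.1.toAlgHom := algHom_ext_UTB F (b := b) fun x hx =>
      congrArg Subtype.val (DFunLike.congr_fun h (⟨x, hx⟩ : UTB F b))
    exact Subtype.ext (AlgEquiv.ext fun x => DFunLike.congr_fun hext x)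
  · intro φ
    obtain ⟨x, hx⟩ := exists_conj_of_algEquiv_UTB F φ
    let u : (Matrix (Fin n) (Fin n) F)ˣ := Units.map (UTB F b).val.toMonoidHom x
    let ψ := MulSemiringAction.toAlgEquiv F (Matrix (Fin n) (Fin n) F) (ConjAct.toConjAct u)
    have hψ (y : UTB F b) : ψ y = φ y := by
      rw [hx]
      rfl
    have hmem : ψ ∈ stabUTB F b := by
      refine le_antisymm ?_ fun y hy => ?_
      · rintro _ ⟨y, hy, rfl⟩
        exact (hψ ⟨y, hy⟩).symm ▸ (φ _).2
      · exact ⟨_, (φ.symm ⟨y, hy⟩).2, (hψ _).trans (by simp)⟩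
    exact ⟨⟨ψ, hmem⟩, AlgEquiv.ext fun y => Subtype.ext (hψ y)⟩

theorem stmt1 {F : Type*} [Field F] {n s : ℕ}
    (nn : Fin s → ℕ) (hpos : ∀ i, 0 < nn i) (hn : n = ∑ i, nn i)
    (b : Fin n → Fin s) (hb : Monotone b)
    (hcard : ∀ i, (Finset.univ.filter fun k => b k = i).card = nn i) :
    ∃ e : stabUTB F b ≃* (↥(UTB F b) ≃ₐ[F] ↥(UTB F b)),
      (∀ (ψ : stabUTB F b) (x : ↥(UTB F b)),
        ((e ψ) x : Matrix (Fin n) (Fin n) F) =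
          (ψ : (Matrix (Fin n) (Fin n) F) ≃ₐ[F] (Matrix (Fin n) (Fin n) F)) ↑x) ∧
      (∀ φ : ↥(UTB F b) ≃ₐ[F] ↥(UTB F b),
        ∃ x : (↥(UTB F b))ˣ, ∀ y : ↥(UTB F b), φ y = ↑x * y * ↑x⁻¹) := by
  exact ⟨MulEquiv.ofBijective (restrictUTB F b) (restrictUTB_bijective F b), fun _ _ => rfl,
    exists_conj_of_algEquiv_UTB F⟩
end

section
/- Let F be a field, G an abelian group, and U = UT(n_1,…,n_s) ⊆ M_n(F). For any G-grading on the associative algebra U, there exists an isomorphic G-grading on U which is in canonical form, i.e. in which each block superdiagonal J_m (0 ≤ m ≤ s−1) is a G-graded subspace. -/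
open Matrix
set_option synthInstance.maxHeartbeats 1000000
set_option maxHeartbeats 1000000

variable (F : Type*) [Field F] {n s : ℕ}

/-- The block superdiagonal `J_m`, viewed as a subspace of `U = UT(n₁,…,n_s)`. -/
def JdiagU (b : Fin n → Fin s) (m : ℤ) : Submodule F ↥(UTB F b) :=
  (Jdiag F b m).comap (UTB F b).val.toLinearMap

/-- A system of matrices over `R` satisfying the relations of the matrix units of the block
triangular algebra attached to `b`, and spanning this algebra. -/
structure IsBlockUnits {R ι : Type*} [CommRing R] [Fintype ι] [DecidableEq ι] {s : ℕ}
    (b : ι → Fin s) (r : ι → ι → Matrix ι ι R) : Prop where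
  tri : ∀ p q, b p ≤ b q → (r p q).BlockTriangular b
  mul : ∀ p q t, b p ≤ b q → b q ≤ b t → r p q * r q t = r p t
  mul_of_ne : ∀ p q q' t, b p ≤ b q → b q' ≤ b t → q ≠ q' → r p q * r q' t = 0
  single_mem : ∀ p q, b p ≤ b q → Matrix.single p q (1 : R) ∈
    Submodule.span R (Set.range fun t : {x : ι × ι // b x.1 ≤ b x.2} => r t.1.1 t.1.2)

/-- The span of the elements `r p q` lying in the ideal generated by `r k k`. -/
def unitIdeal {R ι : Type*} [CommRing R] {s : ℕ} (b : ι → Fin s)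
    (r : ι → ι → Matrix ι ι R) (k : ι) : Submodule R (Matrix ι ι R) :=
  Submodule.span R {y | ∃ p q, b p ≤ b k ∧ b k ≤ b q ∧ y = r p q}

/-- An idempotent ideal of block triangular matrices whose diagonal blocks vanish from the block
`c` on vanishes in all rows from the block `c` on. -/
theorem apply_eq_zero_of_le_mul_self {R ι : Type*} [CommRing R] [Fintype ι] [DecidableEq ι]
    {s : ℕ} (b : ι → Fin s) (K : Submodule R (Matrix ι ι R)) (hK : K ≤ K * K)
    (htri : ∀ y ∈ K, y.BlockTriangular b) (c : ℕ)
    (hdiag : ∀ y ∈ K, ∀ p q, c ≤ b p → b p = b q → y p q = 0) :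
    ∀ y ∈ K, ∀ p q, c ≤ b p → y p q = 0 := by
  have key : ∀ m : ℕ, ∀ y ∈ K, ∀ p q, c ≤ b p → (b q : ℕ) < b p + (m + 1) → y p q = 0 := by
    intro m
    induction m with
    | zero =>
      intro y hy p q hp hq
      rcases (show b q ≤ b p by rw [Fin.le_def]; omega).lt_or_eq with h | h
      · exact htri y hy h
      · exact hdiag y hy p q hp h.symm
    | succ m ih =>
      intro y hy p q hp hq
      refine Submodule.mul_induction_on (C := fun y => y p q = 0) (hK hy) ?_ ?_
      · intro x hx z hz
        rw [Matrix.mul_apply]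
        refine Finset.sum_eq_zero fun t _ => ?_
        by_cases h1 : (b t : ℕ) < b p + (m + 1)
        · rw [ih x hx p t hp h1, zero_mul]
        · rw [ih z hz t q (by omega) (by omega), mul_zero]
      · intro x z hx hz
        rw [Matrix.add_apply, hx, hz, add_zero]
  intro y hy p q hp
  exact key s y hy p q hp (by have := (b q).2; omega)

theorem mem_unitIdeal {R ι : Type*} [CommRing R] {s : ℕ} {b : ι → Fin s}
    (r : ι → ι → Matrix ι ι R) {p q k : ι} (h1 : b p ≤ b k) (h2 : b k ≤ b q) :
    r p q ∈ unitIdeal b r k :=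
  Submodule.subset_span ⟨p, q, h1, h2, rfl⟩

namespace IsBlockUnits

variable {R ι : Type*} [CommRing R] [Fintype ι] [DecidableEq ι] {s : ℕ} {b : ι → Fin s}
  {r : ι → ι → Matrix ι ι R}

theorem single_mul_mem (hr : IsBlockUnits b r) {p q k : ι} (hpq : b p ≤ b q)
    {y : Matrix ι ι R} (hy : y ∈ unitIdeal b r k) :
    Matrix.single p q (1 : R) * y ∈ unitIdeal b r k := by
  have hmem := hr.single_mem p q hpq
  generalize Matrix.single p q (1 : R) = e at hmem ⊢
  induction hmem using Submodule.span_induction with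
  | mem x hx =>
    obtain ⟨⟨⟨u, v⟩, huv⟩, rfl⟩ := hx
    induction hy using Submodule.span_induction with
    | mem y hy =>
      obtain ⟨u', v', hu, hv, rfl⟩ := hy
      by_cases h : v = u'
      · subst h
        simp only
        rw [hr.mul _ _ _ huv (hu.trans hv)]
        exact mem_unitIdeal r (le_trans huv hu) hv
      · simp only
        rw [hr.mul_of_ne _ _ _ _ huv (hu.trans hv) h]
        exact zero_mem _
    | zero => rw [mul_zero]; exact zero_mem _
    | add x y _ _ hx hy => rw [mul_add]; exact add_mem hx hy
    | smul c x _ hx => rw [mul_smul_comm]; exact Submodule.smul_mem _ _ hx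
  | zero => rw [zero_mul]; exact zero_mem _
  | add x y _ _ hx hy => rw [add_mul]; exact add_mem hx hy
  | smul c x _ hx => rw [smul_mul_assoc]; exact Submodule.smul_mem _ _ hx

theorem mul_single_mem (hr : IsBlockUnits b r) {p q k : ι} (hpq : b p ≤ b q)
    {y : Matrix ι ι R} (hy : y ∈ unitIdeal b r k) :
    y * Matrix.single p q (1 : R) ∈ unitIdeal b r k := by
  have hmem := hr.single_mem p q hpq
  generalize Matrix.single p q (1 : R) = e at hmem ⊢
  induction hmem using Submodule.span_induction with
  | mem x hx =>
    obtain ⟨⟨⟨u, v⟩, huv⟩, rfl⟩ := hx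
    induction hy using Submodule.span_induction with
    | mem y hy =>
      obtain ⟨u', v', hu, hv, rfl⟩ := hy
      by_cases h : v' = u
      · subst h
        simp only
        rw [hr.mul _ _ _ (hu.trans hv) huv]
        exact mem_unitIdeal r hu (hv.trans huv)
      · simp only
        rw [hr.mul_of_ne _ _ _ _ (hu.trans hv) huv h]
        exact zero_mem _
    | zero => rw [zero_mul]; exact zero_mem _
    | add x y _ _ hx hy => rw [add_mul]; exact add_mem hx hy
    | smul c x _ hx => rw [smul_mul_assoc]; exact Submodule.smul_mem _ _ hx
  | zero => rw [mul_zero]; exact zero_mem _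
  | add x y _ _ hx hy => rw [mul_add]; exact add_mem hx hy
  | smul c x _ hx => rw [mul_smul_comm]; exact Submodule.smul_mem _ _ hx

theorem mul_eq_zero_of_lt (hr : IsBlockUnits b r) {j k : ι} (hjk : b j < b k)
    {x y : Matrix ι ι R} (hx : x ∈ unitIdeal b r k) (hy : y ∈ unitIdeal b r j) : x * y = 0 := by
  induction hx using Submodule.span_induction with
  | mem x hx =>
    obtain ⟨u, v, hu, hv, rfl⟩ := hx
    induction hy using Submodule.span_induction with
    | mem y hy =>
      obtain ⟨u', v', hu', hv', rfl⟩ := hy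
      refine hr.mul_of_ne _ _ _ _ (hu.trans hv) (hu'.trans hv') ?_
      rintro rfl
      exact absurd (hv.trans hu') (not_le.2 hjk)
    | zero => rw [mul_zero]
    | add x y _ _ hx hy => rw [mul_add, hx, hy, add_zero]
    | smul c x _ hx => rw [mul_smul_comm, hx, smul_zero]
  | zero => rw [zero_mul]
  | add x y _ _ hx hy => rw [add_mul, hx, hy, add_zero]
  | smul c x _ hx => rw [smul_mul_assoc, hx, smul_zero]

theorem unitIdeal_le_mul_self (hr : IsBlockUnits b r) (k : ι) :
    unitIdeal b r k ≤ unitIdeal b r k * unitIdeal b r k := by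
  refine Submodule.span_le.2 ?_
  rintro _ ⟨p, q, hp, hq, rfl⟩
  rw [← hr.mul p k q hp hq]
  exact Submodule.mul_mem_mul (mem_unitIdeal r hp le_rfl) (mem_unitIdeal r le_rfl hq)

theorem blockTriangular_of_mem (hr : IsBlockUnits b r) {k : ι} {y : Matrix ι ι R}
    (hy : y ∈ unitIdeal b r k) : y.BlockTriangular b := by
  induction hy using Submodule.span_induction with
  | mem y hy =>
    obtain ⟨u, v, hu, hv, rfl⟩ := hy
    exact hr.tri u v (hu.trans hv)
  | zero => exact Matrix.blockTriangular_zero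
  | add x y _ _ hx hy => exact hx.add hy
  | smul c x _ hx => exact fun i j hij => by rw [Matrix.smul_apply, hx hij, smul_zero]

theorem self_ne_zero [Nontrivial R] (hr : IsBlockUnits b r) (k : ι) : r k k ≠ 0 := by
  intro h0
  let S := {x : ι × ι // b x.1 ≤ b x.2}
  let L : (S → R) →ₗ[R] (S → R) :=
    { toFun := fun c u => (∑ t : S, c t • r t.1.1 t.1.2) u.1.1 u.1.2
      map_add' := fun c d => by
        funext u
        simp [add_smul, Finset.sum_add_distrib]
      map_smul' := fun a c => by
        funext u
        simp only [Pi.smul_apply, smul_eq_mul, mul_smul, ← Finset.smul_sum, Matrix.smul_apply,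
          RingHom.id_apply] }
  have hL : Function.Surjective L := by
    intro d
    have hd : (∑ t : S, d t • Matrix.single t.1.1 t.1.2 (1 : R)) ∈
        Submodule.span R (Set.range fun t : S => r t.1.1 t.1.2) :=
      Submodule.sum_mem _ fun t _ => Submodule.smul_mem _ _ (hr.single_mem _ _ t.2)
    obtain ⟨c, hc⟩ := (Submodule.mem_span_range_iff_exists_fun R).1 hd
    refine ⟨c, ?_⟩
    funext u
    change (∑ t : S, c t • r t.1.1 t.1.2) u.1.1 u.1.2 = d u
    rw [hc, Matrix.sum_apply, Finset.sum_eq_single u]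
    · simp
    · intro t _ htu
      rw [Matrix.smul_apply, Matrix.single_apply_of_ne, smul_zero]
      rintro ⟨h1, h2⟩
      exact htu (Subtype.ext (Prod.ext h1 h2))
    · simp
  have hinj := OrzechProperty.injective_of_surjective_endomorphism L hL
  have hzero : L (Pi.single ⟨(k, k), le_rfl⟩ 1) = 0 := by
    funext u
    change (∑ t : S, (Pi.single (⟨(k, k), le_rfl⟩ : S) (1 : R) : S → R) t • r t.1.1 t.1.2)
      u.1.1 u.1.2 = 0
    rw [Finset.sum_eq_single ⟨(k, k), le_rfl⟩]
    · simp [h0]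
    · intro t _ ht
      simp [Pi.single_eq_of_ne ht]
    · simp
  have := hinj (hzero.trans (map_zero L).symm)
  simpa using congrFun this ⟨(k, k), le_rfl⟩

theorem sum_self (hr : IsBlockUnits b r) : ∑ k, r k k = 1 := by
  have hone : (1 : Matrix ι ι R) ∈
      Submodule.span R (Set.range fun t : {x : ι × ι // b x.1 ≤ b x.2} => r t.1.1 t.1.2) := by
    rw [← Matrix.sum_single_one]
    exact Submodule.sum_mem _ fun k _ => hr.single_mem k k le_rfl
  rw [← mul_one (∑ k, r k k)]
  generalize (1 : Matrix ι ι R) = e at hone ⊢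
  induction hone using Submodule.span_induction with
  | mem x hx =>
    obtain ⟨⟨⟨u, v⟩, huv⟩, rfl⟩ := hx
    simp only
    rw [Finset.sum_mul, Finset.sum_eq_single u]
    · exact hr.mul _ _ _ le_rfl huv
    · intro k _ hk
      exact hr.mul_of_ne _ _ _ _ le_rfl huv hk
    · simp
  | zero => rw [mul_zero]
  | add x y _ _ hx hy => rw [mul_add, hx, hy]
  | smul c x _ hx => rw [mul_smul_comm, hx]

theorem single_mem_unitIdeal (hr : IsBlockUnits b r) {k p p' p'' : ι} (hu : IsUnit (r k k p p))
    (h1 : b p' ≤ b p) (h2 : b p ≤ b p'') : Matrix.single p' p'' (1 : R) ∈ unitIdeal b r k := by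
  obtain ⟨a, ha⟩ := hu
  have h := hr.mul_single_mem h2 (hr.single_mul_mem h1 (mem_unitIdeal r le_rfl le_rfl : r k k ∈ _))
  rw [Matrix.single_mul_mul_single, ← ha] at h
  have := Submodule.smul_mem _ (↑a⁻¹ : R) h
  simpa using this

theorem apply_eq_zero_of_isUnit (hr : IsBlockUnits b r) {j k p p' p'' : ι}
    (hu : IsUnit (r k k p p)) (hjk : b j ≠ b k) (h1 : b p = b p') (h2 : b p = b p'')
    {y : Matrix ι ι R} (hy : y ∈ unitIdeal b r j) : y p' p'' = 0 := by
  rcases hjk.lt_or_gt with h | h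
  · have := hr.mul_eq_zero_of_lt h (hr.single_mem_unitIdeal hu h1.ge h1.le) hy
    simpa using congrFun (congrFun this p') p''
  · have := hr.mul_eq_zero_of_lt h hy (hr.single_mem_unitIdeal hu h2.ge h2.le)
    simpa using congrFun (congrFun this p') p''

theorem le_of_isUnit [Nontrivial R] (hr : IsBlockUnits b r) {k k' p p' : ι}
    (hu : IsUnit (r k k p p)) (hu' : IsUnit (r k' k' p' p')) (h : b p ≤ b p') : b k ≤ b k' := by
  by_contra! hlt
  have := hr.mul_eq_zero_of_lt hlt (hr.single_mem_unitIdeal hu le_rfl le_rfl)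
    (hr.single_mem_unitIdeal hu' h le_rfl)
  simpa using congrFun (congrFun this p) p'

theorem apply_eq_zero_of_isLocalRing [IsLocalRing R] (hr : IsBlockUnits b r)
    (hb : Function.Surjective b) {p q u v : ι} (hpq : b p ≤ b q) (hpu : b p < b u) :
    r p q u v = 0 := by
  have hex : ∀ p, ∃ k, IsUnit (r k k p p) := by
    intro p
    have h : IsUnit (∑ k, r k k p p) := by
      rw [← Matrix.sum_apply, hr.sum_self, Matrix.one_apply_eq]
      exact isUnit_one
    obtain ⟨k, -, hk⟩ := IsLocalRing.exists_of_isUnit_sum h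
    exact ⟨k, hk⟩
  choose σ hσ using hex
  have hσb : ∀ p p', b p ≤ b p' → b (σ p) ≤ b (σ p') := fun p p' h =>
    hr.le_of_isUnit (hσ p) (hσ p') h
  have hsurj : ∀ k, ∃ p, b (σ p) = b k := by
    intro k
    by_contra! hk
    refine hr.self_ne_zero k ?_
    ext p q
    exact apply_eq_zero_of_le_mul_self b _ (hr.unitIdeal_le_mul_self k)
      (fun y hy => hr.blockTriangular_of_mem hy) 0
      (fun y hy p q _ hpq => hr.apply_eq_zero_of_isUnit (hσ p) (hk p).symm rfl hpq hy)
      _ (mem_unitIdeal r le_rfl le_rfl) p q (Nat.zero_le _)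
  have hid : ∀ p, b (σ p) = b p := by
    choose t ht using hb
    let τ : Fin s → Fin s := fun i => b (σ (t i))
    have hτ : Monotone τ := fun i j hij => hσb _ _ (by rw [ht, ht]; exact hij)
    have hτb : ∀ p, τ (b p) = b (σ p) := fun p =>
      le_antisymm (hσb _ _ (ht _).le) (hσb _ _ (ht _).ge)
    have hτs : Function.Surjective τ := by
      intro j
      obtain ⟨p, hp⟩ := hsurj (t j)
      exact ⟨b p, by rw [hτb, hp, ht]⟩
    have hτm : StrictMono τ := hτ.strictMono_of_injective (Finite.injective_iff_surjective.2 hτs)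
    have hτid : τ = id := hτm.eq_id
    intro p
    rw [← hτb, hτid, id]
  refine apply_eq_zero_of_le_mul_self b _ (hr.unitIdeal_le_mul_self p)
    (fun y hy => hr.blockTriangular_of_mem hy) (b p + 1)
    (fun y hy u v hu huv => hr.apply_eq_zero_of_isUnit (hσ u) ?_ rfl huv hy)
    _ (mem_unitIdeal r le_rfl hpq) u v hpu
  rw [hid]
  exact (Fin.lt_def.2 hu).ne

theorem map {R' : Type*} [CommRing R'] (f : R →+* R') (hr : IsBlockUnits b r) :
    IsBlockUnits b fun p q => (r p q).map f where
  tri p q h i j hij := by rw [Matrix.map_apply, hr.tri p q h hij, map_zero]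
  mul p q t h1 h2 := by rw [← Matrix.map_mul, hr.mul p q t h1 h2]
  mul_of_ne p q q' t h1 h2 h := by
    rw [← Matrix.map_mul, hr.mul_of_ne p q q' t h1 h2 h]
    ext; simp
  single_mem p q h := by
    obtain ⟨c, hc⟩ := (Submodule.mem_span_range_iff_exists_fun R).1 (hr.single_mem p q h)
    refine (Submodule.mem_span_range_iff_exists_fun R').2 ⟨fun t => f (c t), ?_⟩
    have := congrArg (fun M : Matrix ι ι R => M.map f) hc
    simp only [Matrix.map_single, map_one] at this
    rw [← this]
    ext i j
    simp [Matrix.sum_apply]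

theorem apply_eq_zero (hr : IsBlockUnits b r) (hb : Function.Surjective b) {p q u v : ι}
    (hpq : b p ≤ b q) (hpu : b p < b u) : r p q u v = 0 := by
  refine eq_zero_of_localization _ fun J hJ => ?_
  exact (hr.map (algebraMap R (Localization.AtPrime J))).apply_eq_zero_of_isLocalRing hb hpq hpu

end IsBlockUnits

namespace AlgGrading

variable {K A G : Type*} [CommRing K] [Ring A] [Algebra K A]

section Group

variable [Group G] (Γ : AlgGrading K A G)

open scoped Classical in
/-- The decomposition of the algebra into homogeneous components. -/
@[reducible]
noncomputable def decomposition : DirectSum.Decomposition Γ.comp :=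
  (DirectSum.isInternal_submodule_of_iSupIndep_of_iSup_eq_top (A := Γ.comp) Γ.indep
    Γ.total).chooseDecomposition

open scoped Classical in
/-- The projection onto the homogeneous component of degree `g`. -/
noncomputable def proj (g : G) : A →ₗ[K] A :=
  letI := Γ.decomposition
  (Γ.comp g).subtype ∘ₗ DirectSum.component K G (fun g => Γ.comp g) g ∘ₗ
    (DirectSum.decomposeLinearEquiv Γ.comp).toLinearMap

theorem proj_mem (g : G) (x : A) : Γ.proj g x ∈ Γ.comp g :=
  Subtype.prop _

theorem proj_of_mem {g : G} {x : A} (hx : x ∈ Γ.comp g) : Γ.proj g x = x := by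
  classical
  let _ := Γ.decomposition
  exact DirectSum.decompose_of_mem_same Γ.comp hx

theorem proj_of_mem_ne {g h : G} {x : A} (hx : x ∈ Γ.comp g) (hgh : g ≠ h) :
    Γ.proj h x = 0 := by
  classical
  let _ := Γ.decomposition
  exact DirectSum.decompose_of_mem_ne Γ.comp hx hgh

@[elab_as_elim]
theorem induction_homogeneous {motive : A → Prop} (hom : ∀ g, ∀ x ∈ Γ.comp g, motive x)
    (add : ∀ x y, motive x → motive y → motive (x + y)) (x : A) : motive x := by
  have hx : x ∈ ⨆ g, Γ.comp g := Γ.total ▸ Submodule.mem_top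
  exact Submodule.iSup_induction Γ.comp (motive := motive) hx hom (hom 1 0 (zero_mem _)) add

theorem mem_iSup_inf {V : Submodule K A} {x : A} (hx : ∀ g, Γ.proj g x ∈ V) :
    x ∈ ⨆ g, V ⊓ Γ.comp g := by
  classical
  let _ := Γ.decomposition
  rw [← DirectSum.sum_support_decompose Γ.comp x]
  exact Submodule.sum_mem _ fun g _ =>
    Submodule.mem_iSup_of_mem g ⟨hx g, Γ.proj_mem g x⟩

theorem isGradedSubspace_of_proj_mem {V : Submodule K A}
    (hV : ∀ g, ∀ x ∈ V, Γ.proj g x ∈ V) : Γ.IsGradedSubspace V :=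
  le_antisymm (fun x hx => Γ.mem_iSup_inf fun g => hV g x hx) (iSup_le fun _ => inf_le_left)

theorem proj_mul_left {e : A} (he : e ∈ Γ.comp 1) (g : G) (x : A) :
    Γ.proj g (e * x) = e * Γ.proj g x := by
  refine Γ.induction_homogeneous (fun h x hx => ?_) (fun x y hx hy => ?_) x
  · have hex : e * x ∈ Γ.comp h := by simpa using Γ.mul_mem 1 h e he x hx
    by_cases hgh : h = g
    · subst hgh
      rw [Γ.proj_of_mem hex, Γ.proj_of_mem hx]
    · rw [Γ.proj_of_mem_ne hex hgh, Γ.proj_of_mem_ne hx hgh, mul_zero]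
  · rw [mul_add, map_add, map_add, mul_add, hx, hy]

theorem proj_mul_right {e : A} (he : e ∈ Γ.comp 1) (g : G) (x : A) :
    Γ.proj g (x * e) = Γ.proj g x * e := by
  refine Γ.induction_homogeneous (fun h x hx => ?_) (fun x y hx hy => ?_) x
  · have hex : x * e ∈ Γ.comp h := by simpa using Γ.mul_mem h 1 x hx e he
    by_cases hgh : h = g
    · subst hgh
      rw [Γ.proj_of_mem hex, Γ.proj_of_mem hx]
    · rw [Γ.proj_of_mem_ne hex hgh, Γ.proj_of_mem_ne hx hgh, zero_mul]
  · rw [add_mul, map_add, map_add, add_mul, hx, hy]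

theorem proj_mul_of_mem (y : A) {g : G} {x : A} (hx : x ∈ Γ.comp g) :
    Γ.proj g (y * x) = Γ.proj 1 y * x := by
  refine Γ.induction_homogeneous (fun h y hy => ?_) (fun y z hy hz => ?_) y
  · have hyx := Γ.mul_mem h g y hy x hx
    by_cases h1 : h = 1
    · subst h1
      rw [one_mul] at hyx
      rw [Γ.proj_of_mem hyx, Γ.proj_of_mem hy]
    · rw [Γ.proj_of_mem_ne hyx (by simpa using h1), Γ.proj_of_mem_ne hy h1, zero_mul]
  · rw [add_mul, map_add, map_add, add_mul, hy, hz]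

/-- The degree-one component of a left identity of a graded subspace is a left identity. -/
theorem proj_one_mul {V : Submodule K A} (hV : ∀ g, ∀ x ∈ V, Γ.proj g x ∈ V) {e : A}
    (he : ∀ x ∈ V, e * x = x) : ∀ x ∈ V, Γ.proj 1 e * x = x := by
  intro x hx
  have hx' := Γ.mem_iSup_inf fun g => hV g x hx
  refine Submodule.iSup_induction (fun g => V ⊓ Γ.comp g)
    (motive := fun x => Γ.proj 1 e * x = x) hx' ?_ (mul_zero _) ?_
  · intro g x hx
    rw [← Γ.proj_mul_of_mem e hx.2, he x hx.1, Γ.proj_of_mem hx.2]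
  · intro x y hx hy
    rw [mul_add, hx, hy]

/-- The image of a grading under an automorphism. -/
def transport (ψ : A ≃ₐ[K] A) : AlgGrading K A G where
  comp g := (Γ.comp g).map ψ.toLinearMap
  indep g := by
    have := (Submodule.disjoint_map (f := ψ.toLinearMap) ψ.injective (Γ.indep g))
    simpa only [Submodule.map_iSup] using this
  total := by
    rw [← Submodule.map_iSup, Γ.total, Submodule.map_top]
    exact LinearMap.range_eq_top.2 ψ.surjective
  mul_mem := by
    rintro g h _ ⟨x, hx, rfl⟩ _ ⟨y, hy, rfl⟩
    exact ⟨x * y, Γ.mul_mem g h x hx y hy, map_mul ψ x y⟩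

open scoped Classical in
/-- The `MonoidAlgebra`-valued map sending `x` to the sum of `ℓ (x_g) g`. -/
noncomputable def coaction (ℓ : A →ₗ[K] K) : A →ₗ[K] MonoidAlgebra K G :=
  letI := Γ.decomposition
  DirectSum.toModule K G (MonoidAlgebra K G)
    (fun g => MonoidAlgebra.lsingle g ∘ₗ ℓ ∘ₗ (Γ.comp g).subtype) ∘ₗ
    (DirectSum.decomposeLinearEquiv Γ.comp).toLinearMap

theorem coaction_of_mem (ℓ : A →ₗ[K] K) {g : G} {x : A} (hx : x ∈ Γ.comp g) :
    Γ.coaction ℓ x = MonoidAlgebra.single g (ℓ x) := by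
  classical
  let _ := Γ.decomposition
  change DirectSum.toModule K G (MonoidAlgebra K G) _ (DirectSum.decompose Γ.comp x) = _
  rw [DirectSum.decompose_of_mem Γ.comp hx]
  erw [DirectSum.toModule_lof]
  rfl

theorem coeff_coaction (ℓ : A →ₗ[K] K) (g : G) (x : A) :
    (Γ.coaction ℓ x).coeff g = ℓ (Γ.proj g x) := by
  refine Γ.induction_homogeneous (fun h x hx => ?_) (fun x y hx hy => ?_) x
  · rw [Γ.coaction_of_mem ℓ hx]
    by_cases hgh : h = g
    · subst hgh
      simp [Γ.proj_of_mem hx]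
    · simp [Γ.proj_of_mem_ne hx hgh, hgh]
  · simp [hx, hy]

end Group

end AlgGrading

section BlockTriangular

variable {K G : Type*} [Field K] {n s : ℕ} {b : Fin n → Fin s}

/-- The entry functional on the block triangular algebra. -/
def utbEntry (b : Fin n → Fin s) (p q : Fin n) : ↥(UTB K b) →ₗ[K] K :=
  Matrix.entryLinearMap K K p q ∘ₗ (UTB K b).val.toLinearMap

/-- The matrix unit at `(p, q)` if it is block triangular, and zero otherwise. -/
def utbUnit (K : Type*) [Field K] (b : Fin n → Fin s) (p q : Fin n) : ↥(UTB K b) :=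
  ⟨if b p ≤ b q then Matrix.single p q 1 else 0, by
    change Matrix.BlockTriangular _ b
    split_ifs with h
    · exact Matrix.blockTriangular_single h 1
    · exact Matrix.blockTriangular_zero⟩

theorem utb_eq_sum (x : ↥(UTB K b)) :
    x = ∑ p, ∑ q, utbEntry b p q x • utbUnit K b p q := by
  apply Subtype.ext
  simp only [AddSubmonoidClass.coe_finsetSum]
  refine (Matrix.matrix_eq_sum_single x.1).trans ?_
  refine Finset.sum_congr rfl fun p _ => Finset.sum_congr rfl fun q _ => ?_
  change _ = x.1 p q • (if b p ≤ b q then Matrix.single p q (1 : K) else 0)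
  split_ifs with h
  · simp
  · rw [x.2 (not_le.1 h)]
    simp

namespace AlgGrading

variable [CommGroup G] (Γ : AlgGrading K (↥(UTB K b)) G)

/-- The comodule map of a grading, as a map into matrices over the group algebra. -/
noncomputable def matrixCoaction : ↥(UTB K b) →ₗ[K] Matrix (Fin n) (Fin n) (MonoidAlgebra K G) where
  toFun x := Matrix.of fun p q => Γ.coaction (utbEntry b p q) x
  map_add' x y := by refine Matrix.ext fun p q => ?_; simp
  map_smul' c x := by refine Matrix.ext fun p q => ?_; simp

theorem matrixCoaction_of_mem {g : G} {x : ↥(UTB K b)} (hx : x ∈ Γ.comp g) :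
    Γ.matrixCoaction x = x.1.map (MonoidAlgebra.single g) := by
  refine Matrix.ext fun p q => ?_
  exact Γ.coaction_of_mem _ hx

theorem matrixCoaction_mul (x y : ↥(UTB K b)) :
    Γ.matrixCoaction (x * y) = Γ.matrixCoaction x * Γ.matrixCoaction y := by
  refine Γ.induction_homogeneous (fun g x hx => ?_) (fun x z hx hz => ?_) x
  · refine Γ.induction_homogeneous (fun h y hy => ?_) (fun y z hy hz => ?_) y
    · rw [Γ.matrixCoaction_of_mem hx, Γ.matrixCoaction_of_mem hy,
        Γ.matrixCoaction_of_mem (Γ.mul_mem g h x hx y hy)]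
      refine Matrix.ext fun p q => ?_
      simp only [Matrix.map_apply, Matrix.mul_apply, MulMemClass.coe_mul,
        MonoidAlgebra.single_mul_single]
      exact map_sum (MonoidAlgebra.singleAddHom (R := K) (g * h)) _ _
    · rw [mul_add, map_add, map_add, mul_add, hy, hz]
  · rw [add_mul, map_add, map_add, add_mul, hx, hz]

theorem coeff_matrixCoaction (g : G) (x : ↥(UTB K b)) (p q : Fin n) :
    (Γ.matrixCoaction x p q).coeff g = (Γ.proj g x).1 p q :=
  Γ.coeff_coaction _ g x

theorem matrixCoaction_mem_span (x : ↥(UTB K b)) : Γ.matrixCoaction x ∈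
    Submodule.span (MonoidAlgebra K G) (Set.range fun t : {x : Fin n × Fin n // b x.1 ≤ b x.2} =>
      Γ.matrixCoaction (utbUnit K b t.1.1 t.1.2)) := by
  rw [utb_eq_sum x, map_sum]
  refine Submodule.sum_mem _ fun p _ => ?_
  rw [map_sum]
  refine Submodule.sum_mem _ fun q _ => ?_
  rw [map_smul]
  by_cases h : b p ≤ b q
  · rw [← algebraMap_smul (MonoidAlgebra K G)]
    exact Submodule.smul_mem _ _ (Submodule.subset_span ⟨⟨(p, q), h⟩, rfl⟩)
  · have : utbUnit K b p q = 0 := Subtype.ext (if_neg h)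
    rw [this, map_zero, smul_zero]
    exact zero_mem _

theorem map_single_mem_span (x : ↥(UTB K b)) :
    x.1.map (MonoidAlgebra.single (1 : G)) ∈
    Submodule.span (MonoidAlgebra K G) (Set.range fun t : {x : Fin n × Fin n // b x.1 ≤ b x.2} =>
      Γ.matrixCoaction (utbUnit K b t.1.1 t.1.2)) := by
  refine Γ.induction_homogeneous (fun g x hx => ?_) (fun x y hx hy => ?_) x
  · have := Submodule.smul_mem _ (MonoidAlgebra.single g⁻¹ (1 : K)) (Γ.matrixCoaction_mem_span x)
    rw [Γ.matrixCoaction_of_mem hx] at this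
    convert this using 1
    refine Matrix.ext fun p q => ?_
    simp [MonoidAlgebra.single_mul_single]
  · convert add_mem hx hy using 1
    refine Matrix.ext fun p q => ?_
    simp

theorem isBlockUnits :
    IsBlockUnits b fun p q => Γ.matrixCoaction (utbUnit K b p q) where
  tri p q _ u v huv := by
    ext g
    rw [coeff_matrixCoaction, (Γ.proj g _).2 huv]
    simp
  mul p q t h1 h2 := by
    rw [← matrixCoaction_mul]
    congr 1
    apply Subtype.ext
    simp [utbUnit, h1, h2, h1.trans h2]
  mul_of_ne p q q' t h1 h2 h := by
    rw [← matrixCoaction_mul, ← map_zero Γ.matrixCoaction]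
    congr 1
    apply Subtype.ext
    simp [utbUnit, h1, h2, h]
  single_mem p q h := by
    convert Γ.map_single_mem_span (utbUnit K b p q) using 1
    simp only [utbUnit, if_pos h]
    rw [MonoidAlgebra.one_def]
    exact (Matrix.map_single p q (1 : K) (MonoidAlgebra.singleAddHom (1 : G))).symm

end AlgGrading

/-- The ideal of the block triangular matrices supported in the rows of all but the last `m`
blocks. -/
def rowIdeal (K : Type*) [Field K] (b : Fin n → Fin s) (m : ℕ) : Submodule K ↥(UTB K b) where
  carrier := {x | ∀ p q, s ≤ b p + m → x.1 p q = 0}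
  zero_mem' p q _ := rfl
  add_mem' {x y} hx hy p q h := by
    change x.1 p q + y.1 p q = 0
    rw [hx p q h, hy p q h, add_zero]
  smul_mem' c x hx p q h := by
    change c * x.1 p q = 0
    rw [hx p q h, mul_zero]

theorem AlgGrading.proj_mem_rowIdeal [CommGroup G] (Γ : AlgGrading K (↥(UTB K b)) G)
    (hb : Function.Surjective b) (m : ℕ) (g : G) {x : ↥(UTB K b)} (hx : x ∈ rowIdeal K b m) :
    Γ.proj g x ∈ rowIdeal K b m := by
  intro u v hu
  rw [← coeff_matrixCoaction, utb_eq_sum x]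
  simp only [map_sum, map_smul, Matrix.sum_apply, Matrix.smul_apply]
  rw [Finset.sum_eq_zero, MonoidAlgebra.coeff_zero, Finsupp.zero_apply]
  intro p _
  refine Finset.sum_eq_zero fun q _ => ?_
  by_cases hp : s ≤ b p + m
  · have : utbEntry b p q x = 0 := hx p q hp
    rw [this, zero_smul]
  · by_cases h : b p ≤ b q
    · rw [Γ.isBlockUnits.apply_eq_zero hb h (Fin.lt_def.2 (by omega)), smul_zero]
    · have : utbUnit K b p q = 0 := Subtype.ext (if_neg h)
      rw [this, map_zero, Matrix.zero_apply, smul_zero]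

end BlockTriangular
/-- A nested sequence of idempotents, the `m`-th of which is a left identity of the `m`-th term
of a given sequence of subspaces. -/
structure IsIdempotentFlag {K A : Type*} [CommRing K] [Ring A] [Algebra K A]
    (R : ℕ → Submodule K A) (X : ℕ → A) : Prop where
  mem : ∀ m, X m ∈ R m
  left_id : ∀ m, ∀ x ∈ R m, X m * x = x
  mul_of_le : ∀ m j, m ≤ j → X j * X m = X j

namespace IsIdempotentFlag

variable {K A : Type*} [CommRing K] [Ring A] [Algebra K A] {R : ℕ → Submodule K A} {X Y : ℕ → A}

theorem mul_eq_right (hR : Antitone R) (hX : IsIdempotentFlag R X) (hY : IsIdempotentFlag R Y)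
    {m j : ℕ} (h : m ≤ j) : X m * Y j = Y j :=
  hX.left_id m _ (hR h (hY.mem j))

theorem diff_mul_diff (hR : Antitone R) (hX : IsIdempotentFlag R X) {m l : ℕ} (h : m ≠ l) :
    (X m - X (m + 1)) * (X l - X (l + 1)) = 0 := by
  rcases h.lt_or_gt with h | h
  · rw [sub_mul, mul_sub, mul_sub, mul_eq_right hR hX hX h.le,
      mul_eq_right hR hX hX (show m ≤ l + 1 by omega),
      mul_eq_right hR hX hX (show m + 1 ≤ l by omega),
      mul_eq_right hR hX hX (show m + 1 ≤ l + 1 by omega), sub_self]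
  · rw [sub_mul, mul_sub, mul_sub, hX.mul_of_le _ _ h.le,
      hX.mul_of_le _ _ (show l + 1 ≤ m by omega),
      hX.mul_of_le _ _ (show l ≤ m + 1 by omega),
      hX.mul_of_le _ _ (show l + 1 ≤ m + 1 by omega), sub_self, sub_self, sub_self]

theorem diff_mul_self (hR : Antitone R) (hX : IsIdempotentFlag R X) (m : ℕ) :
    (X m - X (m + 1)) * (X m - X (m + 1)) = X m - X (m + 1) := by
  rw [mul_sub, sub_mul, sub_mul, mul_eq_right hR hX hX le_rfl,
    mul_eq_right hR hX hX m.le_succ, mul_eq_right hR hX hX le_rfl,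
    hX.mul_of_le _ _ m.le_succ, sub_self, sub_zero]

theorem diff_mul_diff_mul_diff (hR : Antitone R) (hX : IsIdempotentFlag R X)
    (hY : IsIdempotentFlag R Y) (m : ℕ) :
    (X m - X (m + 1)) * (Y m - Y (m + 1)) * (X m - X (m + 1)) = X m - X (m + 1) := by
  have h : (X m - X (m + 1)) * (Y m - Y (m + 1)) = Y m - X (m + 1) * Y m := by
    rw [sub_mul, mul_sub, mul_sub, mul_eq_right hR hX hY le_rfl,
      mul_eq_right hR hX hY m.le_succ, mul_eq_right hR hX hY le_rfl]
    abel
  rw [h, sub_mul, mul_assoc, mul_sub (Y m), mul_eq_right hR hY hX le_rfl,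
    mul_eq_right hR hY hX m.le_succ, mul_sub, hX.mul_of_le _ _ m.le_succ,
    mul_eq_right hR hX hX le_rfl]
  abel

theorem sum_diff (hX : IsIdempotentFlag R X) (h0 : R 0 = ⊤) {s : ℕ} (hs : R s = ⊥) :
    ∑ m ∈ Finset.range s, (X m - X (m + 1)) = 1 := by
  have h1 := hX.left_id 0 1 (h0 ▸ Submodule.mem_top)
  have h2 : X s = 0 := by simpa [hs] using hX.mem s
  rw [Finset.sum_range_sub', h2, sub_zero, ← h1, mul_one]

theorem sum_mul_sum (hR : Antitone R) (hX : IsIdempotentFlag R X) (hY : IsIdempotentFlag R Y)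
    (h0 : R 0 = ⊤) {s : ℕ} (hs : R s = ⊥) :
    (∑ m ∈ Finset.range s, (X m - X (m + 1)) * (Y m - Y (m + 1))) *
      ∑ m ∈ Finset.range s, (Y m - Y (m + 1)) * (X m - X (m + 1)) = 1 := by
  rw [← hX.sum_diff h0 hs, Finset.sum_mul]
  refine Finset.sum_congr rfl fun m hm => ?_
  rw [Finset.mul_sum, Finset.sum_eq_single_of_mem m hm]
  · calc _ = (X m - X (m + 1)) * ((Y m - Y (m + 1)) * (Y m - Y (m + 1))) *
          (X m - X (m + 1)) := by simp only [mul_assoc]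
      _ = (X m - X (m + 1)) * (Y m - Y (m + 1)) * (X m - X (m + 1)) := by
        rw [diff_mul_self hR hY]
      _ = _ := diff_mul_diff_mul_diff hR hX hY m
  · intro l _ hl
    calc _ = (X m - X (m + 1)) * ((Y m - Y (m + 1)) * (Y l - Y (l + 1))) *
          (X l - X (l + 1)) := by simp only [mul_assoc]
      _ = 0 := by rw [diff_mul_diff hR hY hl.symm, mul_zero, zero_mul]

/-- Two flags of idempotents attached to the same subspaces are conjugate. -/
theorem exists_algEquiv (hR : Antitone R) (hX : IsIdempotentFlag R X) (hY : IsIdempotentFlag R Y)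
    (h0 : R 0 = ⊤) {s : ℕ} (hs : R s = ⊥) :
    ∃ ψ : A ≃ₐ[K] A, ∀ m < s, ψ (X m - X (m + 1)) = Y m - Y (m + 1) := by
  have huv := sum_mul_sum hR hX hY h0 hs
  have hvu := sum_mul_sum hR hY hX h0 hs
  set u := ∑ m ∈ Finset.range s, (X m - X (m + 1)) * (Y m - Y (m + 1)) with hu
  set v := ∑ m ∈ Finset.range s, (Y m - Y (m + 1)) * (X m - X (m + 1)) with hv
  have hXu : ∀ m < s, (X m - X (m + 1)) * u = u * (Y m - Y (m + 1)) := by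
    intro m hm
    rw [hu, Finset.mul_sum, Finset.sum_mul,
      Finset.sum_eq_single_of_mem m (Finset.mem_range.2 hm),
      Finset.sum_eq_single_of_mem m (Finset.mem_range.2 hm)]
    · rw [← mul_assoc, diff_mul_self hR hX, mul_assoc, diff_mul_self hR hY]
    · intro l _ hl
      rw [mul_assoc, diff_mul_diff hR hY hl, mul_zero]
    · intro l _ hl
      rw [← mul_assoc, diff_mul_diff hR hX hl.symm, zero_mul]
  let w : Aˣ := ⟨v, u, hvu, huv⟩
  let ψ : A ≃ₐ[K] A := MulSemiringAction.toAlgEquiv K A (ConjAct.toConjAct w)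
  refine ⟨ψ, fun m hm => ?_⟩
  change v * (X m - X (m + 1)) * u = _
  rw [mul_assoc, hXu m hm, ← mul_assoc, hvu, one_mul]

end IsIdempotentFlag

section BlockTriangular

variable {K G : Type*} [Field K] {n s : ℕ} {b : Fin n → Fin s}

theorem rowIdeal_antitone : Antitone (rowIdeal K b) :=
  fun m j h _ hx p q hp => hx p q (by omega)

theorem rowIdeal_zero : rowIdeal K b 0 = ⊤ := by
  refine top_le_iff.1 fun x _ p q hp => ?_
  have := (b p).2
  omega

theorem rowIdeal_self : rowIdeal K b s = ⊥ := by
  refine le_bot_iff.1 fun x hx => (Submodule.mem_bot K).2 (Subtype.ext (Matrix.ext fun p q => ?_))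
  exact hx p q (Nat.le_add_left s _)

theorem mul_mem_rowIdeal {m : ℕ} {x : ↥(UTB K b)} (hx : x ∈ rowIdeal K b m) (y : ↥(UTB K b)) :
    x * y ∈ rowIdeal K b m := by
  intro p q hp
  change (x.1 * y.1) p q = 0
  rw [Matrix.mul_apply]
  exact Finset.sum_eq_zero fun t _ => by rw [hx p t hp, zero_mul]

/-- The diagonal idempotent generating `rowIdeal K b m`. -/
def rowIdem (K : Type*) [Field K] (b : Fin n → Fin s) (m : ℕ) : ↥(UTB K b) :=
  ⟨Matrix.diagonal fun p => if b p + m < s then 1 else 0, Matrix.blockTriangular_diagonal _⟩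

theorem isIdempotentFlag_rowIdem : IsIdempotentFlag (rowIdeal K b) (rowIdem K b) where
  mem m p q hp := by
    change Matrix.diagonal _ p q = 0
    rw [Matrix.diagonal_apply, if_neg hp.not_gt]
    exact ite_self 0
  left_id m x hx := by
    refine Subtype.ext (Matrix.ext fun p q => ?_)
    change ((Matrix.diagonal _ : Matrix (Fin n) (Fin n) K) * x.1) p q = _
    rw [Matrix.diagonal_mul]
    split_ifs with h
    · rw [one_mul]
    · rw [zero_mul, hx p q (not_lt.1 h)]
  mul_of_le m j h := by
    refine Subtype.ext ?_
    change Matrix.diagonal _ * Matrix.diagonal _ = Matrix.diagonal _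
    rw [Matrix.diagonal_mul_diagonal]
    congr 1
    funext p
    by_cases hj : b p + j < s
    · simp [hj, show b p + m < s by omega]
    · simp [hj]

theorem coe_rowIdem_sub (k : ℕ) : (rowIdem K b k - rowIdem K b (k + 1)).1 =
    Matrix.diagonal fun p => if b p + k + 1 = s then 1 else 0 := by
  change Matrix.diagonal _ - Matrix.diagonal _ = _
  rw [Matrix.diagonal_sub]
  congr 1
  funext p
  rcases lt_trichotomy (b p + k + 1) s with h | h | h
  · simp [h.ne, show b p + k < s by omega, show b p + (k + 1) < s by omega]
  · simp [h, show b p + k < s by omega, show ¬ b p + (k + 1) < s by omega]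
  · simp [h.ne', show ¬ b p + k < s by omega, show ¬ b p + (k + 1) < s by omega]

theorem rowIdem_sub_mul_mul_apply (x : ↥(UTB K b)) (k l : ℕ) (p q : Fin n) :
    ((rowIdem K b k - rowIdem K b (k + 1)) * x * (rowIdem K b l - rowIdem K b (l + 1))).1 p q =
      if b p + k + 1 = s ∧ b q + l + 1 = s then x.1 p q else 0 := by
  rw [MulMemClass.coe_mul, MulMemClass.coe_mul, coe_rowIdem_sub, coe_rowIdem_sub,
    Matrix.mul_diagonal, Matrix.diagonal_mul]
  split_ifs <;> simp_all

namespace AlgGrading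

theorem exists_isIdempotentFlag [CommGroup G] (Γ : AlgGrading K (↥(UTB K b)) G)
    (hb : Function.Surjective b) :
    ∃ X : ℕ → ↥(UTB K b), IsIdempotentFlag (rowIdeal K b) X ∧ ∀ m, X m ∈ Γ.comp 1 := by
  let f : ℕ → ↥(UTB K b) := fun m => Γ.proj 1 (rowIdem K b m)
  have hf : ∀ m, f m ∈ rowIdeal K b m := fun m =>
    Γ.proj_mem_rowIdeal hb m 1 (isIdempotentFlag_rowIdem.mem m)
  have hfid : ∀ m, ∀ x ∈ rowIdeal K b m, f m * x = x := fun m =>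
    Γ.proj_one_mul (fun g x hx => Γ.proj_mem_rowIdeal hb m g hx)
      (isIdempotentFlag_rowIdem.left_id m)
  let X : ℕ → ↥(UTB K b) := fun m => Nat.rec (f 0) (fun m Y => f (m + 1) * Y) m
  have hXs : ∀ m, X (m + 1) = f (m + 1) * X m := fun _ => rfl
  have hX : ∀ m, X m ∈ rowIdeal K b m := by
    rintro (_ | m)
    · exact hf 0
    · exact mul_mem_rowIdeal (hf _) _
  have hXid : ∀ m, ∀ x ∈ rowIdeal K b m, X m * x = x := by
    intro m
    induction m with
    | zero => exact hfid 0
    | succ m ih =>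
      intro x hx
      rw [hXs, mul_assoc, ih x (rowIdeal_antitone m.le_succ hx), hfid _ x hx]
  refine ⟨X, ⟨hX, hXid, fun m j h => ?_⟩, fun m => ?_⟩
  · induction j, h using Nat.le_induction with
    | base => exact hXid m _ (hX m)
    | succ j _ ih => rw [hXs, mul_assoc, ih]
  · induction m with
    | zero => exact Γ.proj_mem 1 _
    | succ m ih =>
      rw [hXs]
      simpa using Γ.mul_mem 1 1 _ (Γ.proj_mem 1 _) _ ih

theorem isGradedSubspace_JdiagU [Group G] (Γ : AlgGrading K (↥(UTB K b)) G)
    (hΓ : ∀ k < s, rowIdem K b k - rowIdem K b (k + 1) ∈ Γ.comp 1) (m : ℤ) :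
    Γ.IsGradedSubspace (JdiagU K b m) := by
  refine Γ.isGradedSubspace_of_proj_mem fun g x hx p q hpq => ?_
  have hp := (b p).2
  have hq := (b q).2
  have hz : (rowIdem K b (s - 1 - b p) - rowIdem K b (s - 1 - b p + 1)) * x *
      (rowIdem K b (s - 1 - b q) - rowIdem K b (s - 1 - b q + 1)) = 0 := by
    refine Subtype.ext (Matrix.ext fun u v => ?_)
    rw [rowIdem_sub_mul_mul_apply]
    split_ifs with h
    · exact hx u v (by omega)
    · rfl
  have h := congrArg (Γ.proj g) hz
  rw [Γ.proj_mul_right (hΓ _ (by omega)), Γ.proj_mul_left (hΓ _ (by omega)), map_zero] at h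
  have h' := congrFun (congrFun (congrArg Subtype.val h) p) q
  rwa [rowIdem_sub_mul_mul_apply, if_pos (by omega)] at h'

end AlgGrading

end BlockTriangular

/-- Up to isomorphism, the differences of a flag of idempotents may be assumed to have degree one as
soon as some flag attached to the same subspaces consists of elements of degree one. -/
theorem AlgGrading.exists_iso_diff_mem_one {K A G : Type*} [CommRing K] [Ring A] [Algebra K A]
    [Group G] (Γ : AlgGrading K A G) {R : ℕ → Submodule K A} {X Y : ℕ → A} (hR : Antitone R)
    (hX : IsIdempotentFlag R X) (hY : IsIdempotentFlag R Y) (h0 : R 0 = ⊤) {s : ℕ}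
    (hs : R s = ⊥) (hX1 : ∀ m, X m ∈ Γ.comp 1) :
    ∃ Γ' : AlgGrading K A G, AlgGrading.Iso Γ Γ' ∧ ∀ m < s, Y m - Y (m + 1) ∈ Γ'.comp 1 := by
  obtain ⟨ψ, hψ⟩ := hX.exists_algEquiv hR hY h0 hs
  refine ⟨Γ.transport ψ, ⟨ψ, fun g => rfl⟩, fun k hk => ?_⟩
  rw [← hψ k hk]
  exact ⟨_, sub_mem (hX1 _) (hX1 _), rfl⟩

theorem stmt3 {F : Type*} [Field F] {G : Type*} [CommGroup G] {n s : ℕ}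
    (nn : Fin s → ℕ) (hpos : ∀ i, 0 < nn i) (hn : n = ∑ i, nn i)
    (b : Fin n → Fin s) (hb : Monotone b)
    (hcard : ∀ i, (Finset.univ.filter fun k => b k = i).card = nn i)
    (Γ : AlgGrading F (↥(UTB F b)) G) :
    ∃ Γ' : AlgGrading F (↥(UTB F b)) G, AlgGrading.Iso Γ Γ' ∧
      ∀ m : ℕ, m < s → Γ'.IsGradedSubspace (JdiagU F b m) := by
  have hsurj : Function.Surjective b := by
    intro i
    obtain ⟨k, hk⟩ := Finset.card_pos.1 ((hpos i).trans_eq (hcard i).symm)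
    exact ⟨k, (Finset.mem_filter.1 hk).2⟩
  obtain ⟨X, hX, hX1⟩ := Γ.exists_isIdempotentFlag hsurj
  obtain ⟨Γ', hΓ', h⟩ := Γ.exists_iso_diff_mem_one rowIdeal_antitone hX isIdempotentFlag_rowIdem
    rowIdeal_zero rowIdeal_self hX1
  exact ⟨Γ', hΓ', fun m _ => Γ'.isGradedSubspace_JdiagU h m⟩
end
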